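/- Assume GCH. Then for every infinite cardinal κ there exists a universal simple graph on vertex set κ: a simple graph on κ into which every simple graph on κ admits a graph embedding. -/

import Mathlib

open Cardinal

/-- The graph on pairs `(a, s)` with `s` a set of predecessors of `a`, in which `(a, s)` is joined to
`(b, t)` for `b < a` precisely when `b ∈ s`. -/
def initialSegmentGraph (α : Type*) [LinearOrder α] : SimpleGraph (Σ a : α, Set (Set.Iio a)) where
  Adj x y := (∃ h : y.1 < x.1, (⟨y.1, h⟩ : Set.Iio x.1) ∈ x.2) ∨
    ∃ h : x.1 < y.1, (⟨x.1, h⟩ : Set.Iio y.1) ∈ y.2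
  symm := ⟨fun _ _ h => h.symm⟩
  loopless := ⟨fun _ h => by
    rcases h with ⟨h, -⟩ | ⟨h, -⟩ <;> exact lt_irrefl _ h⟩

/-- Every graph on a linear order embeds into `initialSegmentGraph`, by sending a vertex to the set
of its smaller neighbours. -/
def SimpleGraph.embeddingInitialSegmentGraph {α : Type*} [LinearOrder α] (G : SimpleGraph α) :
    G ↪g initialSegmentGraph α where
  toFun a := ⟨a, {b | G.Adj a b}⟩
  inj' _ _ h := congrArg Sigma.fst h
  map_rel_iff' := by
    intro a b
    change ((∃ _ : b < a, G.Adj a b) ∨ ∃ _ : a < b, G.Adj b a) ↔ G.Adj a b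
    rcases lt_trichotomy a b with h | rfl | h
    · simp [h, h.not_gt, G.adj_comm]
    · simp
    · simp [h, h.not_gt]

theorem mk_sigma_set_Iio_le {κ : Cardinal.{0}} (hκ : ℵ₀ ≤ κ) (hpow : ∀ μ < κ, 2 ^ μ ≤ κ) :
    #(Σ a : κ.ord.ToType, Set (Set.Iio a)) ≤ κ := by
  rw [mk_sigma]
  calc Cardinal.sum (fun a : κ.ord.ToType => #(Set (Set.Iio a)))
      ≤ Cardinal.sum (fun _ : κ.ord.ToType => κ) := by
        refine sum_le_sum _ _ fun a => ?_
        rw [mk_set]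
        exact hpow _ (by simpa using mk_Iio_lt a (by simp))
    _ = κ := by simp [mul_eq_self hκ]

/-- Assume GCH. Then for every infinite cardinal `κ` there is a universal simple graph on
a vertex set of size `κ`: one into which every simple graph on `κ` vertices embeds as an
induced subgraph. -/
theorem exists_universal_graph_of_GCH
    (GCH : ∀ μ : Cardinal.{0}, ℵ₀ ≤ μ → 2 ^ μ = Order.succ μ)
    (κ : Cardinal.{0}) (hκ : ℵ₀ ≤ κ) :
    ∃ H : SimpleGraph κ.out, ∀ G : SimpleGraph κ.out, Nonempty (G ↪g H) := by
  have hpow : ∀ μ < κ, 2 ^ μ ≤ κ := by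
    intro μ hμ
    rcases lt_or_ge μ ℵ₀ with h | h
    · exact (power_lt_aleph0 natCast_lt_aleph0 h).le.trans hκ
    · rw [GCH μ h]
      exact Order.succ_le_of_lt hμ
  obtain ⟨f⟩ : Nonempty ((Σ a : κ.ord.ToType, Set (Set.Iio a)) ↪ κ.out) := by
    rw [← Cardinal.le_def, mk_out]
    exact mk_sigma_set_Iio_le hκ hpow
  obtain ⟨e⟩ : Nonempty (κ.out ≃ κ.ord.ToType) := by
    rw [← Cardinal.eq, mk_out, mk_ord_toType]
  refine ⟨(initialSegmentGraph κ.ord.ToType).map f, fun G => ⟨?_⟩⟩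
  exact (SimpleGraph.Embedding.map f _).comp
    ((SimpleGraph.embeddingInitialSegmentGraph (G.map e.toEmbedding)).comp
      (SimpleGraph.Embedding.map e.toEmbedding G))
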